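/- Let F be a field with two automorphisms σ, τ satisfying στ = τσ⁻¹, and let n > 2. Let x_0, ..., x_{n−2} be algebraically independent over F, set x_{n−1} := −(x_0 + ... + x_{n−2}), and let L = F(x_0,...,x_{n−2}). Then σ extends to an automorphism σ′ of L with σ′(x_i) = x_{i+1} for 0 ≤ i ≤ n−2 (and σ′(x_{n−1}) = x_0), and τ extends to an automorphism τ′ of L with τ′(x_0) = −x_0 and τ′(x_i) = −x_{n−i} for 1 ≤ i ≤ n−2, and the extended automorphisms satisfy σ′τ′ = τ′σ′⁻¹. -/

import Mathlib

noncomputable section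

open MvPolynomial

/-- For `n = m + 3 > 2`: the tuple `x₀, …, x_{n-1}` in `L = F(x₀,…,x_{n-2})`, where
`x₀, …, x_{n-2}` are the algebraically independent generators (images of the variables of
the polynomial ring) and `x_{n-1} := -(x₀ + ⋯ + x_{n-2})`. -/
def xg (F : Type*) [Field F] (m : ℕ) :
    Fin (m + 3) → FractionRing (MvPolynomial (Fin (m + 2)) F) := fun i =>
  if h : (i : ℕ) < m + 2 then
    algebraMap (MvPolynomial (Fin (m + 2)) F) _ (MvPolynomial.X (⟨i, h⟩ : Fin (m + 2)))
  else
    - ∑ j : Fin (m + 2), algebraMap (MvPolynomial (Fin (m + 2)) F) _ (MvPolynomial.X j)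

/-- The structure embedding `F → L = F(x₀,…,x_{n-2})`. -/
def cg (F : Type*) [Field F] (m : ℕ) : F →+* FractionRing (MvPolynomial (Fin (m + 2)) F) :=
  (algebraMap (MvPolynomial (Fin (m + 2)) F) _).comp MvPolynomial.C

section SignedPermutation

variable {F : Type*} [Field F] {m : ℕ}

/-- The polynomials `x₀, …, x_{n-1}`, where the last one is minus the sum of the variables. -/
def xpoly (F : Type*) [Field F] (m : ℕ) : Fin (m + 3) → MvPolynomial (Fin (m + 2)) F :=
  Fin.lastCases (-∑ j, X j) X

@[simp]
lemma xpoly_castSucc (j : Fin (m + 2)) : xpoly F m j.castSucc = X j := by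
  simp [xpoly]

@[simp]
lemma xpoly_last : xpoly F m (Fin.last (m + 2)) = -∑ j, X j := by
  simp [xpoly]

lemma sum_xpoly : ∑ i, xpoly F m i = 0 := by
  simp [Fin.sum_univ_castSucc]

lemma algebraMap_xpoly (i : Fin (m + 3)) :
    algebraMap _ (FractionRing (MvPolynomial (Fin (m + 2)) F)) (xpoly F m i) = xg F m i := by
  cases i using Fin.lastCases <;> simp [xg]

/-- The `ρ`-semilinear endomorphism of the polynomial ring sending `xᵢ` to `ε • x_{π i}`. -/
def signedPermHom (ρ : F →+* F) (π : Equiv.Perm (Fin (m + 3))) (ε : ℤˣ) :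
    MvPolynomial (Fin (m + 2)) F →+* MvPolynomial (Fin (m + 2)) F :=
  eval₂Hom (C.comp ρ) fun j => (ε : ℤ) • xpoly F m (π j.castSucc)

@[simp]
lemma signedPermHom_C (ρ : F →+* F) (π : Equiv.Perm (Fin (m + 3))) (ε : ℤˣ) (a : F) :
    signedPermHom ρ π ε (C a) = C (ρ a) := by
  simp [signedPermHom]

@[simp]
lemma signedPermHom_xpoly (ρ : F →+* F) (π : Equiv.Perm (Fin (m + 3))) (ε : ℤˣ)
    (i : Fin (m + 3)) :
    signedPermHom ρ π ε (xpoly F m i) = (ε : ℤ) • xpoly F m (π i) := by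
  cases i using Fin.lastCases with
  | cast j => rw [xpoly_castSucc, signedPermHom, coe_eval₂Hom, eval₂_X]
  | last =>
    have h : ∑ i, xpoly F m (π i) = 0 := (Equiv.sum_comp π _).trans sum_xpoly
    rw [Fin.sum_univ_castSucc] at h
    rw [eq_neg_of_add_eq_zero_right h, xpoly_last, map_neg, map_sum, smul_neg, Finset.smul_sum]
    simp [signedPermHom]

lemma ringHom_ext_xpoly {R : Type*} [CommSemiring R]
    {f g : MvPolynomial (Fin (m + 2)) F →+* R} (hC : ∀ a, f (C a) = g (C a))
    (hx : ∀ i, f (xpoly F m i) = g (xpoly F m i)) : f = g :=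
  MvPolynomial.ringHom_ext hC fun j => by simpa using hx j.castSucc

/-- The `ρ`-semilinear automorphism of the polynomial ring sending `xᵢ` to `ε • x_{π i}`. -/
def signedPermEquiv (ρ : F ≃+* F) (π : Equiv.Perm (Fin (m + 3))) (ε : ℤˣ) :
    MvPolynomial (Fin (m + 2)) F ≃+* MvPolynomial (Fin (m + 2)) F :=
  RingEquiv.ofRingHom (signedPermHom ρ π ε) (signedPermHom ρ.symm π.symm ε)
    (ringHom_ext_xpoly (by simp) fun i => by simp [← mul_assoc, ← Int.cast_mul, ← Units.val_mul])
    (ringHom_ext_xpoly (by simp) fun i => by simp [← mul_assoc, ← Int.cast_mul, ← Units.val_mul])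

/-- The extension of `ρ` to the rational function field sending `xᵢ` to `ε • x_{π i}`. -/
def signedPermFieldEquiv (ρ : F ≃+* F) (π : Equiv.Perm (Fin (m + 3))) (ε : ℤˣ) :
    FractionRing (MvPolynomial (Fin (m + 2)) F) ≃+*
      FractionRing (MvPolynomial (Fin (m + 2)) F) :=
  IsFractionRing.ringEquivOfRingEquiv (signedPermEquiv ρ π ε)

@[simp]
lemma signedPermFieldEquiv_cg (ρ : F ≃+* F) (π : Equiv.Perm (Fin (m + 3))) (ε : ℤˣ) (a : F) :
    signedPermFieldEquiv ρ π ε (cg F m a) = cg F m (ρ a) := by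
  simp [signedPermFieldEquiv, cg, signedPermEquiv]

@[simp]
lemma signedPermFieldEquiv_xg (ρ : F ≃+* F) (π : Equiv.Perm (Fin (m + 3))) (ε : ℤˣ)
    (i : Fin (m + 3)) :
    signedPermFieldEquiv ρ π ε (xg F m i) = (ε : ℤ) • xg F m (π i) := by
  rw [← algebraMap_xpoly, ← algebraMap_xpoly, signedPermFieldEquiv,
    IsFractionRing.ringEquivOfRingEquiv_algebraMap, ← map_zsmul,
    ← signedPermHom_xpoly (ρ : F →+* F)]
  rfl

lemma fractionRing_ringHom_ext {R : Type*} [CommSemiring R]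
    {f g : FractionRing (MvPolynomial (Fin (m + 2)) F) →+* R}
    (hC : ∀ a, f (cg F m a) = g (cg F m a)) (hx : ∀ i, f (xg F m i) = g (xg F m i)) : f = g :=
  IsLocalization.ringHom_ext (nonZeroDivisors (MvPolynomial (Fin (m + 2)) F)) <|
    ringHom_ext_xpoly hC fun i => by simpa [algebraMap_xpoly] using hx i

end SignedPermutation

/-- Let `F` be a field with automorphisms `σ, τ` satisfying `στ = τσ⁻¹`, and let
`n = m + 3 > 2`. Let `x₀, …, x_{n-2}` be algebraically independent over `F`, set
`x_{n-1} := -(x₀ + ⋯ + x_{n-2})`, and `L = F(x₀,…,x_{n-2})`. Then `σ` extends to an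
automorphism `σ′` of `L` with `σ′(xᵢ) = x_{i+1}` (indices mod `n`, so in particular
`σ′(x_{n-1}) = x₀`), `τ` extends to an automorphism `τ′` of `L` with `τ′(x₀) = -x₀` and
`τ′(xᵢ) = -x_{n-i}` for `1 ≤ i ≤ n-2`, and the extensions satisfy `σ′τ′ = τ′σ′⁻¹`. -/
theorem statement8 (F : Type*) [Field F] (σ τ : F ≃+* F)
    (hrel : ∀ a : F, σ (τ a) = τ (σ.symm a)) (m : ℕ) :
    ∃ σ' τ' : FractionRing (MvPolynomial (Fin (m + 2)) F) ≃+*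
        FractionRing (MvPolynomial (Fin (m + 2)) F),
      (∀ a : F, σ' (cg F m a) = cg F m (σ a)) ∧
      (∀ a : F, τ' (cg F m a) = cg F m (τ a)) ∧
      (∀ i : Fin (m + 3), σ' (xg F m i) = xg F m (i + 1)) ∧
      (τ' (xg F m 0) = - xg F m 0) ∧
      (∀ i : Fin (m + 3), i ≠ 0 → (i : ℕ) ≤ m + 1 → τ' (xg F m i) = - xg F m (-i)) ∧
      (∀ z, σ' (τ' z) = τ' (σ'.symm z)) := by
  set σ' := signedPermFieldEquiv (m := m) σ (Equiv.addRight 1) 1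
  set τ' := signedPermFieldEquiv (m := m) τ (Equiv.neg _) (-1)
  have hσ : ∀ i, σ' (xg F m i) = xg F m (i + 1) := fun i => by simp [σ']
  have hτ : ∀ i, τ' (xg F m i) = -xg F m (-i) := fun i => by simp [τ']
  have hσc : ∀ a, σ' (cg F m a) = cg F m (σ a) := signedPermFieldEquiv_cg _ _ _
  have hτc : ∀ a, τ' (cg F m a) = cg F m (τ a) := signedPermFieldEquiv_cg _ _ _
  refine ⟨σ', τ', hσc, hτc, hσ, by simpa using hτ 0, fun i _ _ => hτ i, fun z => ?_⟩
  have hσc_symm : ∀ a, σ'.symm (cg F m a) = cg F m (σ.symm a) := fun a => by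
    rw [RingEquiv.symm_apply_eq, hσc, RingEquiv.apply_symm_apply]
  have hσ_symm : ∀ i, σ'.symm (xg F m i) = xg F m (i - 1) := fun i => by
    rw [RingEquiv.symm_apply_eq, hσ, sub_add_cancel]
  have hcomp : (τ'.trans σ').toRingHom = (σ'.symm.trans τ').toRingHom :=
    fractionRing_ringHom_ext (fun a => by simp [hσc, hτc, hσc_symm, hrel])
      fun i => by simp [hσ, hτ, hσ_symm, sub_eq_neg_add, add_comm]
  exact RingHom.congr_fun hcomp z
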